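/- (Discretization-error bound ε₃, from the proof of Theorem 4.5) Let σ_f, σ_l > 0, let k be the Gaussian kernel on ℝⁿ, let P be a Borel probability measure on ℝⁿ, let s₁, …, s_m be pairwise disjoint Borel subsets of ℝⁿ with P(s₁ ∪ … ∪ s_m) = 1, and let c₁, …, c_m ∈ ℝⁿ. Define the discrete measure Q := Σ_{i=1}^{m} P(s_i) · δ_{c_i}. Suppose ε₃ ≥ 0 satisfies k(c_i, c_i) + k(y, y) − 2 k(c_i, y) ≤ ε₃² for every i ∈ {1, …, m} and every y ∈ s_i. Then MMD²(Q, P) ≤ ε₃². -/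

import Mathlib

open MeasureTheory
open scoped BigOperators

/-- The Gaussian kernel on `ℝⁿ` with parameters `σf, σl`. -/
noncomputable def gaussianKernel (σf σl : ℝ) {n : ℕ}
    (x y : EuclideanSpace ℝ (Fin n)) : ℝ :=
  σf ^ 2 * Real.exp (-‖x - y‖ ^ 2 / (2 * σl ^ 2))

/-- Squared maximum mean discrepancy w.r.t. the kernel `k`. -/
noncomputable def mmdSq {n : ℕ}
    (k : EuclideanSpace ℝ (Fin n) → EuclideanSpace ℝ (Fin n) → ℝ)
    (P Q : Measure (EuclideanSpace ℝ (Fin n))) : ℝ :=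
  (∫ y, (∫ y', k y y' ∂P) ∂P) + (∫ y, (∫ y', k y y' ∂Q) ∂Q)
    - 2 * ∫ y, (∫ y', k y y' ∂Q) ∂P

lemma gaussianKernel_comm (σf σl : ℝ) {n : ℕ} (x y : EuclideanSpace ℝ (Fin n)) :
    gaussianKernel σf σl x y = gaussianKernel σf σl y x := by
  simp only [gaussianKernel, norm_sub_rev x y]

lemma continuous_uncurry_gaussianKernel (σf σl : ℝ) (n : ℕ) :
    Continuous fun p : EuclideanSpace ℝ (Fin n) × EuclideanSpace ℝ (Fin n) ↦
      gaussianKernel σf σl p.1 p.2 := by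
  unfold gaussianKernel
  fun_prop

lemma norm_gaussianKernel_le (σf σl : ℝ) {n : ℕ} (x y : EuclideanSpace ℝ (Fin n)) :
    ‖gaussianKernel σf σl x y‖ ≤ σf ^ 2 := by
  rw [gaussianKernel, Real.norm_of_nonneg (by positivity)]
  refine mul_le_of_le_one_right (sq_nonneg _) (Real.exp_le_one_iff.2 ?_)
  exact div_nonpos_of_nonpos_of_nonneg (by simp) (by positivity)

lemma integrable_cos_inner {n : ℕ} (μ : Measure (EuclideanSpace ℝ (Fin n))) [IsFiniteMeasure μ]
    (t : EuclideanSpace ℝ (Fin n)) : Integrable (fun w ↦ Real.cos (inner ℝ w t)) μ :=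
  Integrable.of_bound (by fun_prop) 1 (ae_of_all _ fun _ ↦ Real.abs_cos_le_one _)

lemma integral_cos_inner_stdGaussian {n : ℕ} (t : EuclideanSpace ℝ (Fin n)) :
    ∫ w, Real.cos (inner ℝ w t) ∂(ProbabilityTheory.stdGaussian (EuclideanSpace ℝ (Fin n))) =
      Real.exp (-‖t‖ ^ 2 / 2) := by
  have h := congrArg Complex.re (ProbabilityTheory.charFun_stdGaussian t)
  have hint : Integrable (fun w ↦ Complex.exp ((inner ℝ w t : ℝ) * Complex.I))
      (ProbabilityTheory.stdGaussian (EuclideanSpace ℝ (Fin n))) :=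
    Integrable.of_bound (by fun_prop) 1
      (ae_of_all _ fun _ ↦ (Complex.norm_exp_ofReal_mul_I _).le)
  rw [charFun_apply, ← RCLike.re_eq_complex_re, ← integral_re hint] at h
  simp only [RCLike.re_eq_complex_re, Complex.exp_ofReal_mul_I_re] at h
  rw [h]
  rw [← Complex.ofReal_re (Real.exp (-‖t‖ ^ 2 / 2))]
  push_cast
  rfl

/-- Bochner's representation of the Gaussian kernel. -/
lemma gaussianKernel_eq_integral_cos (σf σl : ℝ) {n : ℕ} (x y : EuclideanSpace ℝ (Fin n)) :
    gaussianKernel σf σl x y = σf ^ 2 * ∫ w, Real.cos (inner ℝ w (σl⁻¹ • (x - y)))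
      ∂(ProbabilityTheory.stdGaussian (EuclideanSpace ℝ (Fin n))) := by
  rw [integral_cos_inner_stdGaussian, gaussianKernel, norm_smul, mul_pow, Real.norm_eq_abs, sq_abs]
  congr 2
  rw [inv_pow, neg_div, neg_div, div_eq_mul_inv, mul_inv]
  ring

lemma cos_four_point_le (a a' x x' : ℝ) :
    Real.cos (a - a') + Real.cos (x - x') - Real.cos (a - x') - Real.cos (x - a') ≤
      (1 - Real.cos (a - x)) + (1 - Real.cos (a' - x')) := by
  simp only [Real.cos_sub]
  nlinarith [sq_nonneg (Real.cos a - Real.cos x - Real.cos a' + Real.cos x'),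
    sq_nonneg (Real.sin a - Real.sin x - Real.sin a' + Real.sin x'),
    Real.sin_sq_add_cos_sq a, Real.sin_sq_add_cos_sq a',
    Real.sin_sq_add_cos_sq x, Real.sin_sq_add_cos_sq x']

/-- The positive semidefiniteness of the Gaussian kernel for four points
with the weights `1, -1, -1, 1`. -/
lemma gaussianKernel_four_point_le (σf σl : ℝ) {n : ℕ} (a a' x x' : EuclideanSpace ℝ (Fin n)) :
    gaussianKernel σf σl a a' + gaussianKernel σf σl x x'
        - gaussianKernel σf σl a x' - gaussianKernel σf σl x a' ≤
      (σf ^ 2 - gaussianKernel σf σl a x) + (σf ^ 2 - gaussianKernel σf σl a' x') := by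
  let μ := ProbabilityTheory.stdGaussian (EuclideanSpace ℝ (Fin n))
  have hi := fun y z : EuclideanSpace ℝ (Fin n) ↦ integrable_cos_inner μ (σl⁻¹ • (y - z))
  have key := integral_mono
    ((((hi a a').add (hi x x')).add (hi a x)).add (hi a' x'))
    (((integrable_const (2 : ℝ)).add (hi a x')).add (hi x a')) fun w ↦ by
      have := cos_four_point_le (inner ℝ w (σl⁻¹ • a)) (inner ℝ w (σl⁻¹ • a'))
        (inner ℝ w (σl⁻¹ • x)) (inner ℝ w (σl⁻¹ • x'))
      simp only [Pi.add_apply, smul_sub, inner_sub_right]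
      linarith
  rw [integral_add' (((hi a a').add (hi x x')).add (hi a x)) (hi a' x'),
    integral_add' ((hi a a').add (hi x x')) (hi a x), integral_add' (hi a a') (hi x x'),
    integral_add' ((integrable_const (2 : ℝ)).add (hi a x')) (hi x a'),
    integral_add' (integrable_const (2 : ℝ)) (hi a x')] at key
  simp only [integral_const, probReal_univ, smul_eq_mul, one_mul] at key
  simp only [gaussianKernel_eq_integral_cos]
  have := mul_le_mul_of_nonneg_left key (sq_nonneg σf)
  simp only [μ] at this
  linarith

lemma integrable_gaussianKernel_comp (σf σl : ℝ) {n : ℕ} {α : Type*} [MeasurableSpace α]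
    (μ : Measure α) [IsFiniteMeasure μ] {f g : α → EuclideanSpace ℝ (Fin n)}
    (hf : Measurable f) (hg : Measurable g) :
    Integrable (fun a ↦ gaussianKernel σf σl (f a) (g a)) μ :=
  Integrable.of_bound
    ((continuous_uncurry_gaussianKernel σf σl n).measurable.comp
      (hf.prodMk hg)).aestronglyMeasurable
    (σf ^ 2) (ae_of_all _ fun _ ↦ norm_gaussianKernel_le _ _ _ _)

lemma integral_integral_gaussianKernel_map (σf σl : ℝ) {n : ℕ} {α : Type*} [MeasurableSpace α]
    (μ : Measure α) [IsFiniteMeasure μ] {f g : α → EuclideanSpace ℝ (Fin n)}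
    (hf : Measurable f) (hg : Measurable g) :
    ∫ y, (∫ y', gaussianKernel σf σl y y' ∂(μ.map g)) ∂(μ.map f) =
      ∫ p, gaussianKernel σf σl (f p.1) (g p.2) ∂(μ.prod μ) := by
  rw [← integral_prod _ (integrable_gaussianKernel_comp σf σl _ measurable_fst measurable_snd),
    Measure.map_prod_map _ _ hf hg, integral_map (hf.prodMap hg).aemeasurable
      (continuous_uncurry_gaussianKernel σf σl n).aestronglyMeasurable]
  rfl

/-- Moving mass by `T` changes a distribution by at most the largest feature-space displacement. -/
lemma mmdSq_gaussianKernel_map_le (σf σl : ℝ) {n : ℕ} (P : Measure (EuclideanSpace ℝ (Fin n)))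
    [IsProbabilityMeasure P] {T : EuclideanSpace ℝ (Fin n) → EuclideanSpace ℝ (Fin n)}
    (hT : Measurable T) {r : ℝ}
    (hr : ∀ᵐ y ∂P, 2 * (σf ^ 2 - gaussianKernel σf σl (T y) y) ≤ r) :
    mmdSq (gaussianKernel σf σl) (P.map T) P ≤ r := by
  have hTT := integral_integral_gaussianKernel_map σf σl P hT hT
  have hII := integral_integral_gaussianKernel_map σf σl P measurable_id measurable_id
  have hTI := integral_integral_gaussianKernel_map σf σl P hT measurable_id
  rw [Measure.map_id] at hII hTI
  have hsymm : ∫ p, gaussianKernel σf σl (id p.1) (T p.2) ∂(P.prod P) =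
      ∫ p, gaussianKernel σf σl (T p.1) (id p.2) ∂(P.prod P) := by
    rw [← integral_prod_swap]
    simp only [Prod.fst_swap, Prod.snd_swap, gaussianKernel_comm σf σl (id _)]
  have hi {f g : EuclideanSpace ℝ (Fin n) → EuclideanSpace ℝ (Fin n)}
      (hf : Measurable f) (hg : Measurable g) :=
    integrable_gaussianKernel_comp σf σl (P.prod P)
      (hf.comp measurable_fst) (hg.comp measurable_snd)
  have hadd := (hi hT hT).add (hi measurable_id measurable_id)
  have hsub := hadd.sub (hi hT measurable_id)
  have key := integral_mono_ae (hsub.sub (hi measurable_id hT)) (integrable_const r) <| by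
    filter_upwards [Measure.quasiMeasurePreserving_fst.ae hr,
      Measure.quasiMeasurePreserving_snd.ae hr] with p h₁ h₂
    have := gaussianKernel_four_point_le σf σl (T p.1) (T p.2) p.1 p.2
    simp only [Pi.sub_apply, Pi.add_apply, Function.comp_apply, id_eq]
    linarith
  rw [integral_sub' hsub (hi measurable_id hT), integral_sub' hadd (hi hT measurable_id),
    integral_add' (hi hT hT) (hi measurable_id measurable_id)] at key
  simp only [Function.comp_apply, integral_const, probReal_univ, smul_eq_mul, one_mul] at key
  rw [mmdSq, hTT, hII, hTI]
  linarith

lemma map_eq_sum_smul_dirac {α β ι : Type*} [MeasurableSpace α] [MeasurableSpace β] [Fintype ι]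
    {μ : Measure α} {s : ι → Set α} (hs : ∀ i, MeasurableSet (s i))
    (hdisj : Pairwise (Function.onFun Disjoint s)) (hcover : ∀ᵐ x ∂μ, x ∈ ⋃ i, s i)
    {c : ι → β} {T : α → β} (hT : Measurable T) (hTs : ∀ i, ∀ x ∈ s i, T x = c i) :
    μ.map T = ∑ i, μ (s i) • Measure.dirac (c i) := by
  have hμ : μ = Measure.sum fun i ↦ μ.restrict (s i) := by
    rw [← Measure.restrict_iUnion hdisj hs, Measure.restrict_eq_self_of_ae_mem hcover]
  conv_lhs => rw [hμ]
  rw [Measure.map_sum hT.aemeasurable, Measure.sum_fintype]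
  refine Finset.sum_congr rfl fun i _ ↦ ?_
  rw [Measure.map_congr (ae_restrict_of_forall_mem (hs i) (hTs i)), Measure.map_const,
    Measure.restrict_apply_univ]

lemma sum_indicator_const_of_mem {α ι M : Type*} [Fintype ι] [AddCommMonoid M] {s : ι → Set α}
    (hdisj : Pairwise (Function.onFun Disjoint s)) (c : ι → M) {i : ι} {x : α} (hx : x ∈ s i) :
    ∑ j, (s j).indicator (fun _ ↦ c j) x = c i := by
  rw [Finset.sum_eq_single i, Set.indicator_of_mem hx]
  · exact fun j _ hj ↦ Set.indicator_of_notMem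
      (Set.disjoint_right.1 (hdisj hj) hx) _
  · simp

theorem mmdSq_discretization_error_bound {n : ℕ} (σf σl : ℝ)
    (hσf : 0 < σf) (hσl : 0 < σl)
    (k : EuclideanSpace ℝ (Fin n) → EuclideanSpace ℝ (Fin n) → ℝ)
    (hk : k = gaussianKernel σf σl)
    (P : Measure (EuclideanSpace ℝ (Fin n))) [IsProbabilityMeasure P]
    (m : ℕ) (s : Fin m → Set (EuclideanSpace ℝ (Fin n)))
    (hmeas : ∀ i, MeasurableSet (s i))
    (hdisj : Pairwise (Function.onFun Disjoint s))
    (hcover : P (⋃ i, s i) = 1)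
    (c : Fin m → EuclideanSpace ℝ (Fin n))
    (Q : Measure (EuclideanSpace ℝ (Fin n)))
    (hQ : Q = ∑ i : Fin m, (P (s i)) • Measure.dirac (c i))
    (ε₃ : ℝ) (hε₃ : 0 ≤ ε₃)
    (hbound : ∀ i : Fin m, ∀ y ∈ s i,
      k (c i) (c i) + k y y - 2 * k (c i) y ≤ ε₃ ^ 2) :
    mmdSq k Q P ≤ ε₃ ^ 2 := by
  subst hk
  let T : EuclideanSpace ℝ (Fin n) → EuclideanSpace ℝ (Fin n) :=
    fun y ↦ ∑ i, (s i).indicator (fun _ ↦ c i) y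
  have hT : Measurable T :=
    Finset.measurable_fun_sum _ fun i _ ↦ measurable_const.indicator (hmeas i)
  have hTs (i : Fin m) : ∀ y ∈ s i, T y = c i :=
    fun y hy ↦ sum_indicator_const_of_mem hdisj c hy
  have hmem : ∀ᵐ y ∂P, y ∈ ⋃ i, s i :=
    (prob_compl_eq_zero_iff (MeasurableSet.iUnion hmeas)).2 hcover
  rw [hQ, ← map_eq_sum_smul_dirac hmeas hdisj hmem hT hTs]
  refine mmdSq_gaussianKernel_map_le σf σl P hT ?_
  filter_upwards [hmem] with y hy
  obtain ⟨i, hi⟩ := Set.mem_iUnion.1 hy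
  have hself (x : EuclideanSpace ℝ (Fin n)) : gaussianKernel σf σl x x = σf ^ 2 := by
    simp [gaussianKernel]
  have h := hbound i y hi
  rw [hself, hself] at h
  rw [hTs i y hi]
  linarith
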